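/- arXiv:1811.07644 — 4 statements merged into one kernel-verified Lean document; each statement's English description precedes it below -/
import Mathlib

section
/- Guarded terms are stable under substitution: if M is a guarded term over context Γ, x:τ with Γ, x:τ ⊢ M : σ, and N is a guarded term over Γ with Γ ⊢ N : τ, then M[N/x] is a guarded term over Γ with Γ ⊢ M[N/x] : σ. -/
/-! ## Simple types with a single base type `ι` -/

/-- Simple types over the single base type `ι`. -/
inductive Ty : Type
  | base : Ty
  | arrow : Ty → Ty → Ty

/-- The order of a type: `ord ι = 0`, `ord (σ→τ) = max (ord σ + 1) (ord τ)`. -/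
def Ty.order : Ty → ℕ
  | .base => 0
  | .arrow σ τ => max (σ.order + 1) τ.order

/-- The arity of a (first-order) type: `ar ι = 0`, `ar (ι→τ) = ar τ + 1`. -/
def Ty.arity : Ty → ℕ
  | .base => 0
  | .arrow _ τ => τ.arity + 1

/-- A term signature assigns types to (some) constant names. -/
abbrev Sig : Type := String → Option Ty

/-- A signature is first-order if every symbol has a type of order ≤ 1. -/
def Sig.FirstOrder (Sg : Sig) : Prop := ∀ c τ, Sg c = some τ → τ.order ≤ 1

/-- The arity of a symbol of a (first-order) signature. -/
def Sig.ar (Sg : Sig) (c : String) : ℕ := ((Sg c).map Ty.arity).getD 0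

/-! ## Terms (de Bruijn representation) -/

/-- Terms of the simply typed λ-calculus with constants and a fixed point
operator `fix`, in de Bruijn representation. -/
inductive Tm : Type
  | var : ℕ → Tm
  | const : String → Tm
  | app : Tm → Tm → Tm
  | lam : Ty → Tm → Tm
  | fix : Ty → Tm → Tm

/-- Shift ("weakening") of de Bruijn indices `≥ c` by `d`. -/
def Tm.shift (d : ℕ) : ℕ → Tm → Tm
  | c, .var n => if n < c then .var n else .var (n + d)
  | _, .const f => .const f
  | c, .app M N => .app (Tm.shift d c M) (Tm.shift d c N)
  | c, .lam τ M => .lam τ (Tm.shift d (c + 1) M)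
  | c, .fix τ M => .fix τ (Tm.shift d (c + 1) M)

/-- Capture-avoiding substitution `Tm.subst k N M = M[N/k]` of the
de Bruijn variable `k` by `N` in `M`. -/
def Tm.subst : ℕ → Tm → Tm → Tm
  | k, N, .var n => if n = k then Tm.shift k 0 N else if k < n then .var (n - 1) else .var n
  | _, _, .const f => .const f
  | k, N, .app M₁ M₂ => .app (Tm.subst k N M₁) (Tm.subst k N M₂)
  | k, N, .lam τ M => .lam τ (Tm.subst (k + 1) N M)
  | k, N, .fix τ M => .fix τ (Tm.subst (k + 1) N M)

/-- Typing contexts: lists of types (the head is de Bruijn index 0). -/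
abbrev Ctx : Type := List Ty

/-- Typing judgement `Γ ⊢ M : τ` over the signature `Sg`. -/
inductive HasTy (Sg : Sig) : Ctx → Tm → Ty → Prop
  | var {Γ n τ} : Γ[n]? = some τ → HasTy Sg Γ (.var n) τ
  | const {Γ c τ} : Sg c = some τ → HasTy Sg Γ (.const c) τ
  | app {Γ M N σ τ} : HasTy Sg Γ M (.arrow σ τ) → HasTy Sg Γ N σ → HasTy Sg Γ (.app M N) τ
  | lam {Γ M σ τ} : HasTy Sg (σ :: Γ) M τ → HasTy Sg Γ (.lam σ M) (.arrow σ τ)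
  | fixI {Γ M τ} : HasTy Sg (τ :: Γ) M τ → HasTy Sg Γ (.fix τ M) τ

/-- `lams n M` is the `n`-fold λ-abstraction `λ y₁ … yₙ. M` (all of base type). -/
def lams : ℕ → Tm → Tm
  | 0, M => M
  | n + 1, M => .lam .base (lams n M)

/-- `apps M [N₁, …, Nₙ]` is the iterated application `M N₁ … Nₙ`. -/
def apps : Tm → List Tm → Tm
  | M, [] => M
  | M, N :: Ns => apps (.app M N) Ns

/-- Guarded base terms `Γ ⊢g M : τ`. -/
inductive GBase (Sg : Sig) : Ctx → Tm → Ty → Prop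
  | var {Γ n τ} : Γ[n]? = some τ → τ.order ≤ 1 → GBase Sg Γ (.var n) τ
  | const {Γ c τ} : Sg c = some τ → GBase Sg Γ (.const c) τ
  | app {Γ M N σ τ} : GBase Sg Γ M (.arrow σ τ) → GBase Sg Γ N σ → GBase Sg Γ (.app M N) τ
  | fixI {Γ f σf τ Ms} : Sg f = some σf → τ.order ≤ 1 →
      Ms.length = σf.arity →
      (∀ M ∈ Ms, GBase Sg (List.replicate τ.arity Ty.base ++ τ :: Γ) M .base) →
      GBase Sg Γ (.fix τ (lams τ.arity (apps (.const f) Ms))) τ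

/-- Guarded terms: generated from closed guarded base terms, constants and
variables by application and λ-abstraction (equivalently: all `fix`-subterms
occur inside closed guarded base subterms). -/
inductive Guarded (Sg : Sig) : Tm → Prop
  | base {M τ} : GBase Sg [] M τ → Guarded Sg M
  | const {c} : Guarded Sg (.const c)
  | var {n} : Guarded Sg (.var n)
  | app {M N} : Guarded Sg M → Guarded Sg N → Guarded Sg (.app M N)
  | lam {τ M} : Guarded Sg M → Guarded Sg (.lam τ M)

theorem shift_lams (d n c : ℕ) (M : Tm) :
    Tm.shift d c (lams n M) = lams n (Tm.shift d (c + n) M) := by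
  induction n generalizing c with
  | zero => rfl
  | succ n ih =>
    simp only [lams, Tm.shift, ih]
    rw [show c + 1 + n = c + (n + 1) by omega]

theorem subst_lams (n k : ℕ) (N M : Tm) :
    Tm.subst k N (lams n M) = lams n (Tm.subst (k + n) N M) := by
  induction n generalizing k with
  | zero => rfl
  | succ n ih =>
    simp only [lams, Tm.subst, ih]
    rw [show k + 1 + n = k + (n + 1) by omega]

theorem shift_apps_eq (d c : ℕ) (Ms : List Tm) (F : Tm) (hF : Tm.shift d c F = F)
    (h : ∀ M ∈ Ms, Tm.shift d c M = M) : Tm.shift d c (apps F Ms) = apps F Ms := by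
  induction Ms generalizing F with
  | nil => exact hF
  | cons A As ih =>
    refine ih _ ?_ (fun M hM => h M (List.mem_cons_of_mem _ hM))
    simp [Tm.shift, hF, h A]

theorem subst_apps_eq (k : ℕ) (N : Tm) (Ms : List Tm) (F : Tm) (hF : Tm.subst k N F = F)
    (h : ∀ M ∈ Ms, Tm.subst k N M = M) : Tm.subst k N (apps F Ms) = apps F Ms := by
  induction Ms generalizing F with
  | nil => exact hF
  | cons A As ih =>
    refine ih _ ?_ (fun M hM => h M (List.mem_cons_of_mem _ hM))
    simp [Tm.subst, hF, h A]

/-- Shifting above the context leaves guarded base terms unchanged. -/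
theorem GBase.shift_eq {Sg : Sig} {Γ : Ctx} {M : Tm} {τ : Ty} (h : GBase Sg Γ M τ) (d : ℕ) :
    ∀ c, Γ.length ≤ c → Tm.shift d c M = M := by
  induction h with
  | @var Γ n τ h _ =>
    intro c hc
    obtain ⟨hn, _⟩ := List.getElem?_eq_some_iff.mp h
    simp only [Tm.shift]
    rw [if_pos (by omega)]
  | const => intro c _; rfl
  | app _ _ ih1 ih2 => intro c hc; simp only [Tm.shift, ih1 c hc, ih2 c hc]
  | fixI _ _ _ _ ih =>
    intro c hc
    simp only [Tm.shift, shift_lams]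
    rw [shift_apps_eq _ _ _ _ rfl]
    intro M hM
    apply ih M hM
    simp
    omega

/-- Substituting above the context leaves guarded base terms unchanged. -/
theorem GBase.subst_eq {Sg : Sig} {Γ : Ctx} {M : Tm} {τ : Ty} (h : GBase Sg Γ M τ) (N : Tm) :
    ∀ k, Γ.length ≤ k → Tm.subst k N M = M := by
  induction h with
  | @var Γ n τ h _ =>
    intro c hc
    obtain ⟨hn, _⟩ := List.getElem?_eq_some_iff.mp h
    simp only [Tm.subst]
    rw [if_neg (by omega), if_neg (by omega)]
  | const => intro c _; rfl
  | app _ _ ih1 ih2 => intro c hc; simp only [Tm.subst, ih1 c hc, ih2 c hc]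
  | fixI _ _ _ _ ih =>
    intro c hc
    simp only [Tm.subst, subst_lams]
    rw [subst_apps_eq _ _ _ _ rfl]
    intro M hM
    apply ih M hM
    simp
    omega

theorem Guarded.shift_guarded {Sg : Sig} {M : Tm} (h : Guarded Sg M) (d : ℕ) :
    ∀ c, Guarded Sg (Tm.shift d c M) := by
  induction h with
  | base h => intro c; rw [h.shift_eq d c (Nat.zero_le _)]; exact .base h
  | const => intro c; exact .const
  | var => intro c; simp only [Tm.shift]; split <;> exact .var
  | app _ _ ih1 ih2 => intro c; exact .app (ih1 c) (ih2 c)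
  | lam _ ih => intro c; exact .lam (ih _)

theorem Guarded.subst_guarded {Sg : Sig} {M N : Tm} (h : Guarded Sg M) (hN : Guarded Sg N) :
    ∀ k, Guarded Sg (Tm.subst k N M) := by
  induction h with
  | base h => intro c; rw [h.subst_eq N c (Nat.zero_le _)]; exact .base h
  | const => intro c; exact .const
  | var =>
    intro c
    simp only [Tm.subst]
    split
    · exact hN.shift_guarded _ _
    · split <;> exact .var
  | app _ _ ih1 ih2 => intro c; exact .app (ih1 c) (ih2 c)
  | lam _ ih => intro c; exact .lam (ih _)

theorem HasTy.shift_typed {Sg : Sig} {Γ : Ctx} {M : Tm} {σ : Ty} (h : HasTy Sg Γ M σ) :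
    ∀ (A D B : Ctx), Γ = A ++ B →
      HasTy Sg (A ++ (D ++ B)) (Tm.shift D.length A.length M) σ := by
  induction h with
  | @var Γ n τ h =>
    rintro A D B rfl
    simp only [Tm.shift]
    split
    · next hn =>
      rw [List.getElem?_append_left hn] at h
      exact .var (by rw [List.getElem?_append_left hn, h])
    · next hn =>
      rw [List.getElem?_append_right (by omega)] at h
      refine .var ?_
      rw [List.getElem?_append_right (by omega), List.getElem?_append_right (by omega), ← h]
      congr 1
      omega
  | const h => intro A D B _; exact .const h
  | app _ _ ih1 ih2 => intro A D B e; exact .app (ih1 A D B e) (ih2 A D B e)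
  | lam _ ih => rintro A D B rfl; exact .lam (ih (_ :: A) D B rfl)
  | fixI _ ih => rintro A D B rfl; exact .fixI (ih (_ :: A) D B rfl)

theorem HasTy.subst_typed {Sg : Sig} {Γ Δ : Ctx} {M N : Tm} {σ τ : Ty}
    (h : HasTy Sg Δ M σ) (hN : HasTy Sg Γ N τ) :
    ∀ (A : Ctx), Δ = A ++ τ :: Γ → HasTy Sg (A ++ Γ) (Tm.subst A.length N M) σ := by
  induction h with
  | @var _ n ρ h =>
    rintro A rfl
    simp only [Tm.subst]
    split
    · next hn =>
      subst hn
      simp at h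
      subst h
      exact hN.shift_typed [] A Γ rfl
    · split
      · next h1 h2 =>
        refine .var ?_
        rw [List.getElem?_append_right (by omega)] at h ⊢
        rw [show n - A.length = (n - 1 - A.length) + 1 by omega, List.getElem?_cons_succ] at h
        exact h
      · next h1 h2 =>
        refine .var ?_
        rw [List.getElem?_append_left (by omega)] at h ⊢
        exact h
  | const h => intro A _; exact .const h
  | app _ _ ih1 ih2 => intro A e; exact .app (ih1 A e) (ih2 A e)
  | lam _ ih => rintro A rfl; exact .lam (ih (_ :: A) rfl)
  | fixI _ ih => rintro A rfl; exact .fixI (ih (_ :: A) rfl)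

/-- **Guarded terms are stable under substitution**: if `M` is a guarded term
with `Γ, x:τ ⊢ M : σ` and `N` is a guarded term with `Γ ⊢ N : τ`, then
`M[N/x]` is a guarded term with `Γ ⊢ M[N/x] : σ`. -/
theorem Guarded.subst_stable (Sg : Sig) (Γ : Ctx) (τ σ : Ty) (M N : Tm)
    (hMg : Guarded Sg M) (hMt : HasTy Sg (τ :: Γ) M σ)
    (hNg : Guarded Sg N) (hNt : HasTy Sg Γ N τ) :
    Guarded Sg (Tm.subst 0 N M) ∧ HasTy Sg Γ (Tm.subst 0 N M) σ := by
  exact ⟨hMg.subst_guarded hNg 0, hMt.subst_typed hNt [] rfl⟩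
end

section
/- There is a map ⟦-⟧ from first-order guarded terms of base type over context Γ to coterms over Γ that is unique with the properties: (1) if M and N are convertible then ⟦M⟧ = ⟦N⟧; and (2) for all M, if M ↠ f N₁…N_{ar(f)} then root_Γ(⟦M⟧) = f(⟦N₁⟧,…,⟦N_{ar(f)}⟧), and if M ↠ x then root_Γ(⟦M⟧) = x. -/
/-! ## Reduction and conversion -/

/-- One-step β/fix-reduction (compatible closure). -/
inductive Red : Tm → Tm → Prop
  | beta {τ M N} : Red (.app (.lam τ M) N) (Tm.subst 0 N M)
  | fixUnfold {τ M} : Red (.fix τ M) (Tm.subst 0 (.fix τ M) M)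
  | appL {M M' N} : Red M M' → Red (.app M N) (.app M' N)
  | appR {M N N'} : Red N N' → Red (.app M N) (.app M N')
  | lam {τ M M'} : Red M M' → Red (.lam τ M) (.lam τ M')
  | fixC {τ M M'} : Red M M' → Red (.fix τ M) (.fix τ M')

/-- Multi-step reduction `↠`. -/
def RedStar : Tm → Tm → Prop := Relation.ReflTransGen Red

/-- Convertibility: equivalence closure of reduction. -/
def Conv : Tm → Tm → Prop := Relation.EqvGen Red

/-! ## Coterms: the final coalgebra of `⟦Σ⟧(X) + V` -/

/-- The polynomial functor `X ↦ ⟦Σ⟧(X) + V` of a (first-order) signature,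
with a set `V` of variables. -/
def coSig (Sg : Sig) (V : Type) : PFunctor.{0} where
  A := String ⊕ V
  B := fun a => match a with
    | Sum.inl c => Fin (Sg.ar c)
    | Sum.inr _ => Empty

/-- Coterms over `Σ` and variables `V`: the final coalgebra (M-type) of
`⟦Σ⟧(-) + V`; `PFunctor.M.dest` is the structure map `root`. -/
def CoTerm (Sg : Sig) (V : Type) : Type := (coSig Sg V).M

/-- First-order guarded terms of base type over the context `Γ`. -/
def GFOTm (Sg : Sig) (Γ : Ctx) : Type :=
  {M : Tm // Guarded Sg M ∧ HasTy Sg Γ M .base}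

/-! ## Parallel renaming and substitution -/

namespace Tm

def upr (r : ℕ → ℕ) : ℕ → ℕ
  | 0 => 0
  | n + 1 => r n + 1

def ren : (ℕ → ℕ) → Tm → Tm
  | r, .var n => .var (r n)
  | _, .const f => .const f
  | r, .app M N => .app (ren r M) (ren r N)
  | r, .lam τ M => .lam τ (ren (upr r) M)
  | r, .fix τ M => .fix τ (ren (upr r) M)

def up (s : ℕ → Tm) : ℕ → Tm
  | 0 => .var 0
  | n + 1 => ren Nat.succ (s n)

def inst : (ℕ → Tm) → Tm → Tm
  | s, .var n => s n
  | _, .const f => .const f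
  | s, .app M N => .app (inst s M) (inst s N)
  | s, .lam τ M => .lam τ (inst (up s) M)
  | s, .fix τ M => .fix τ (inst (up s) M)

def scons (N : Tm) (s : ℕ → Tm) : ℕ → Tm
  | 0 => N
  | n + 1 => s n

theorem ren_ren (M : Tm) : ∀ (r q : ℕ → ℕ), ren q (ren r M) = ren (fun n => q (r n)) M := by
  induction M with
  | var n => intro r q; rfl
  | const f => intro r q; rfl
  | app M N ih1 ih2 => intro r q; simp [ren, ih1, ih2]
  | lam τ M ih | fix τ M ih =>
    intro r q
    simp only [ren, ih]
    congr 2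
    funext n; cases n <;> rfl

theorem inst_ren (M : Tm) : ∀ (r : ℕ → ℕ) (s : ℕ → Tm),
    inst s (ren r M) = inst (fun n => s (r n)) M := by
  induction M with
  | var n => intro r q; rfl
  | const f => intro r q; rfl
  | app M N ih1 ih2 => intro r q; simp [ren, inst, ih1, ih2]
  | lam τ M ih | fix τ M ih =>
    intro r q
    simp only [ren, inst, ih]
    congr 2
    funext n; cases n <;> rfl

theorem ren_inst (M : Tm) : ∀ (s : ℕ → Tm) (r : ℕ → ℕ),
    ren r (inst s M) = inst (fun n => ren r (s n)) M := by
  induction M with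
  | var n => intro r q; rfl
  | const f => intro r q; rfl
  | app M N ih1 ih2 => intro r q; simp [ren, inst, ih1, ih2]
  | lam τ M ih | fix τ M ih =>
    intro r q
    simp only [ren, inst, ih]
    congr 2
    funext n; cases n
    · rfl
    · simp only [up, ren_ren]; rfl

theorem inst_inst (M : Tm) : ∀ (s t : ℕ → Tm),
    inst t (inst s M) = inst (fun n => inst t (s n)) M := by
  induction M with
  | var n => intro r q; rfl
  | const f => intro r q; rfl
  | app M N ih1 ih2 => intro r q; simp [inst, ih1, ih2]
  | lam τ M ih | fix τ M ih =>
    intro r q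
    simp only [inst, ih]
    congr 2
    funext n; cases n
    · rfl
    · simp only [up, ren_inst, inst_ren]

theorem up_var : up Tm.var = Tm.var := by
  funext n; cases n <;> rfl

theorem inst_var (M : Tm) : inst Tm.var M = M := by
  induction M with
  | var n => rfl
  | const f => rfl
  | app M N ih1 ih2 => simp [inst, ih1, ih2]
  | lam τ M ih | fix τ M ih => simp [inst, up_var, ih]

theorem ren_eq_inst (M : Tm) (r : ℕ → ℕ) : ren r M = inst (fun n => .var (r n)) M := by
  have := inst_ren M r Tm.var
  rwa [inst_var] at this

theorem ren_id' (M : Tm) : ren (fun n => n) M = M := by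
  rw [ren_eq_inst]; exact inst_var M

theorem inst_scons_up (M N : Tm) (s : ℕ → Tm) :
    inst (scons N Tm.var) (inst (up s) M) = inst (scons N s) M := by
  rw [inst_inst]
  congr 1
  funext n; cases n
  · rfl
  · simp only [up, inst_ren]
    exact inst_var _

theorem inst_inst_scons (M N : Tm) (s : ℕ → Tm) :
    inst s (inst (scons N Tm.var) M) = inst (scons (inst s N) s) M := by
  rw [inst_inst]
  congr 1
  funext n; cases n <;> rfl

theorem inst_inst_scons' (M N : Tm) (s t : ℕ → Tm) :
    inst t (inst (scons N s) M) = inst (scons (inst t N) (fun n => inst t (s n))) M := by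
  rw [inst_inst]
  congr 1
  funext n; cases n <;> rfl

theorem shift_eq (d : ℕ) (M : Tm) : ∀ c,
    shift d c M = ren (fun n => if n < c then n else n + d) M := by
  induction M with
  | var n => intro c; simp only [shift, ren]; split <;> rfl
  | const f => intro c; rfl
  | app M N ih1 ih2 => intro c; simp [shift, ren, ih1, ih2]
  | lam τ M ih | fix τ M ih =>
    intro c
    simp only [shift, ren, ih]
    congr 2
    funext n; cases n
    · simp [upr]
    · simp only [upr]; split <;> split <;> omega

theorem subst_eq (N M : Tm) : ∀ k, subst k N M = inst (fun n =>
    if n = k then ren (fun i => i + k) N else if k < n then .var (n - 1) else .var n) M := by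
  induction M with
  | var n => intro k; simp only [subst, inst, shift_eq]; simp
  | const f => intro c; rfl
  | app M N ih1 ih2 => intro c; simp [subst, inst, ih1, ih2]
  | lam τ M ih | fix τ M ih =>
    intro k
    simp only [subst, inst, ih]
    congr 2
    funext n; cases n with
    | zero => simp [up]
    | succ n =>
      simp only [up]
      by_cases h : n = k
      · simp [h, ren_ren, Nat.add_assoc]
      · by_cases h2 : k < n
        · simp only [h, h2, if_false, if_true, Nat.add_right_cancel_iff,
            Nat.add_lt_add_iff_right, ren]
          congr 1; omega
        · simp only [h, h2, if_false, Nat.add_right_cancel_iff,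
            Nat.add_lt_add_iff_right, ren]

theorem subst_zero (N M : Tm) : subst 0 N M = inst (scons N Tm.var) M := by
  rw [subst_eq]
  congr 1
  funext n; cases n
  · simp [scons, ren_id']
  · simp [scons]

end Tm

open Tm

/-! ## Parallel reduction and confluence -/

inductive Par : Tm → Tm → Prop
  | var {n} : Par (.var n) (.var n)
  | const {c} : Par (.const c) (.const c)
  | app {M M' N N'} : Par M M' → Par N N' → Par (.app M N) (.app M' N')
  | lam {τ M M'} : Par M M' → Par (.lam τ M) (.lam τ M')
  | fixC {τ M M'} : Par M M' → Par (.fix τ M) (.fix τ M')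
  | beta {τ M M' N N'} : Par M M' → Par N N' →
      Par (.app (.lam τ M) N) (inst (scons N' Tm.var) M')
  | fixU {τ M M'} : Par M M' → Par (.fix τ M) (inst (scons (.fix τ M') Tm.var) M')

theorem Par.rfl' (M : Tm) : Par M M := by
  induction M with
  | var n => exact .var
  | const f => exact .const
  | app M N ih1 ih2 => exact .app ih1 ih2
  | lam τ M ih => exact .lam ih
  | fix τ M ih => exact .fixC ih

theorem ren_inst_scons (M N : Tm) (r : ℕ → ℕ) :
    ren r (inst (scons N Tm.var) M) = inst (scons (ren r N) Tm.var) (ren (upr r) M) := by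
  rw [ren_inst, inst_ren]
  congr 1
  funext n; cases n <;> rfl

theorem Par.ren {M M' : Tm} (h : Par M M') : ∀ r, Par (Tm.ren r M) (Tm.ren r M') := by
  induction h with
  | var => intro r; exact .var
  | const => intro r; exact .const
  | app _ _ ih1 ih2 => intro r; exact .app (ih1 r) (ih2 r)
  | lam _ ih => intro r; exact .lam (ih _)
  | fixC _ ih => intro r; exact .fixC (ih _)
  | beta _ _ ih1 ih2 => intro r; rw [ren_inst_scons]; exact .beta (ih1 _) (ih2 _)
  | fixU _ ih => intro r; rw [ren_inst_scons]; exact .fixU (ih _)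

theorem Par.up {s t : ℕ → Tm} (h : ∀ n, Par (s n) (t n)) : ∀ n, Par (Tm.up s n) (Tm.up t n)
  | 0 => .var
  | n + 1 => (h n).ren _

theorem Par.inst {M M' : Tm} (h : Par M M') : ∀ {s t : ℕ → Tm}, (∀ n, Par (s n) (t n)) →
    Par (Tm.inst s M) (Tm.inst t M') := by
  induction h with
  | var => intro s t h; exact h _
  | const => intro s t h; exact .const
  | app _ _ ih1 ih2 => intro s t h; exact .app (ih1 h) (ih2 h)
  | lam _ ih => intro s t h; exact .lam (ih (Par.up h))
  | fixC _ ih => intro s t h; exact .fixC (ih (Par.up h))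
  | beta _ _ ih1 ih2 =>
    intro s t h
    rw [inst_inst_scons, ← inst_scons_up]
    exact .beta (ih1 (Par.up h)) (ih2 h)
  | fixU _ ih =>
    intro s t h
    rw [inst_inst_scons, ← inst_scons_up]
    exact .fixU (ih (Par.up h))

theorem Par.inst1 {M M' N N' : Tm} (h : Par M M') (h2 : Par N N') :
    Par (Tm.inst (scons N Tm.var) M) (Tm.inst (scons N' Tm.var) M') := by
  apply h.inst
  intro n; cases n
  · exact h2
  · exact .var

/-- Complete development. -/
def cdev : Tm → Tm
  | .var n => .var n
  | .const c => .const c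
  | .app (.lam _ M) N => inst (scons (cdev N) Tm.var) (cdev M)
  | .app M N => .app (cdev M) (cdev N)
  | .lam τ M => .lam τ (cdev M)
  | .fix τ M => inst (scons (.fix τ (cdev M)) Tm.var) (cdev M)

theorem Par.cdev {M N : Tm} (h : Par M N) : Par N (cdev M) := by
  induction h with
  | var => exact .var
  | const => exact .const
  | @app M M' N N' h1 h2 ih1 ih2 =>
    cases h1 with
    | lam h =>
      simp only [_root_.cdev] at ih1 ⊢
      cases ih1 with
      | lam h' => exact .beta h' ih2
    | _ => exact .app ih1 ih2
  | lam _ ih => exact .lam ih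
  | fixC _ ih => exact .fixU ih
  | beta _ _ ih1 ih2 => exact ih1.inst1 ih2
  | fixU _ ih => exact ih.inst1 (.fixC ih)

theorem Red.par {M N : Tm} (h : Red M N) : Par M N := by
  induction h with
  | beta => rw [subst_zero]; exact .beta (.rfl' _) (.rfl' _)
  | fixUnfold => rw [subst_zero]; exact .fixU (.rfl' _)
  | appL _ ih => exact .app ih (.rfl' _)
  | appR _ ih => exact .app (.rfl' _) ih
  | lam _ ih => exact .lam ih
  | fixC _ ih => exact .fixC ih

theorem RedStar.app {M M' N N' : Tm} (h1 : RedStar M M') (h2 : RedStar N N') :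
    RedStar (.app M N) (.app M' N') :=
  (Relation.ReflTransGen.lift (fun M => Tm.app M N) (fun _ _ => Red.appL) _ _ h1).trans
    (Relation.ReflTransGen.lift (fun N => Tm.app M' N) (fun _ _ => Red.appR) _ _ h2)

theorem RedStar.lam {τ} {M M' : Tm} (h1 : RedStar M M') : RedStar (.lam τ M) (.lam τ M') :=
  Relation.ReflTransGen.lift (fun M => Tm.lam τ M) (fun _ _ => Red.lam) _ _ h1

theorem RedStar.fix {τ} {M M' : Tm} (h1 : RedStar M M') : RedStar (.fix τ M) (.fix τ M') :=
  Relation.ReflTransGen.lift (fun M => Tm.fix τ M) (fun _ _ => Red.fixC) _ _ h1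

theorem Par.redStar {M N : Tm} (h : Par M N) : RedStar M N := by
  induction h with
  | var => exact .refl
  | const => exact .refl
  | app _ _ ih1 ih2 => exact ih1.app ih2
  | lam _ ih => exact ih.lam
  | fixC _ ih => exact ih.fix
  | beta _ _ ih1 ih2 =>
    refine (ih1.lam.app ih2).tail ?_
    rw [← subst_zero]; exact .beta
  | fixU _ ih =>
    refine ih.fix.tail ?_
    rw [← subst_zero]; exact .fixUnfold

theorem redStar_iff_par {M N : Tm} : RedStar M N ↔ Relation.ReflTransGen Par M N := by
  constructor
  · intro h; exact Relation.ReflTransGen.mono (fun _ _ => Red.par) _ _ h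
  · intro h
    induction h with
    | refl => exact .refl
    | tail _ h ih => exact ih.trans h.redStar

theorem confluence {M N P : Tm} (h1 : RedStar M N) (h2 : RedStar M P) :
    ∃ Q, RedStar N Q ∧ RedStar P Q := by
  rw [redStar_iff_par] at h1 h2
  obtain ⟨Q, h3, h4⟩ := Relation.church_rosser
    (fun a b c hb hc => ⟨cdev a, .single hb.cdev, .single hc.cdev⟩) h1 h2
  exact ⟨Q, redStar_iff_par.2 h3, redStar_iff_par.2 h4⟩

theorem Conv.join {M N : Tm} (h : Conv M N) : ∃ Q, RedStar M Q ∧ RedStar N Q := by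
  induction h with
  | rel a b h => exact ⟨b, .single h, .refl⟩
  | refl a => exact ⟨a, .refl, .refl⟩
  | symm a b _ ih => obtain ⟨q, h1, h2⟩ := ih; exact ⟨q, h2, h1⟩
  | trans a b c _ _ ih1 ih2 =>
    obtain ⟨q, h1, h2⟩ := ih1
    obtain ⟨q', h3, h4⟩ := ih2
    obtain ⟨w, h5, h6⟩ := confluence h2 h3
    exact ⟨w, h1.trans h5, h4.trans h6⟩

theorem RedStar.conv {M N : Tm} (h : RedStar M N) : Conv M N := by
  induction h with
  | refl => exact .refl _
  | tail _ h ih => exact .trans _ _ _ ih (.rel _ _ h)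

theorem Conv.rfl' (M : Tm) : Conv M M := Relation.EqvGen.refl _
theorem Conv.symm' {M N : Tm} (h : Conv M N) : Conv N M := Relation.EqvGen.symm _ _ h
theorem Conv.trans' {M N P : Tm} (h : Conv M N) (h2 : Conv N P) : Conv M P :=
  Relation.EqvGen.trans _ _ _ h h2

theorem Conv.app {M M' N N' : Tm} (h1 : Conv M M') (h2 : Conv N N') :
    Conv (.app M N) (.app M' N') := by
  obtain ⟨P, hP1, hP2⟩ := h1.join
  obtain ⟨Q, hQ1, hQ2⟩ := h2.join
  exact (hP1.app hQ1).conv.trans' (hP2.app hQ2).conv.symm'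

theorem Conv.apps {Ns Ns' : List Tm} (h : List.Forall₂ Conv Ns Ns') :
    ∀ {M M' : Tm}, Conv M M' → Conv (apps M Ns) (apps M' Ns') := by
  induction h with
  | nil => intro M M' h; exact h
  | cons h _ ih => intro M M' hM; exact ih (hM.app h)

/-! ## Inversion for constant-headed terms -/

theorem apps_append (M : Tm) (Ns : List Tm) (N : Tm) : apps M (Ns ++ [N]) = .app (apps M Ns) N := by
  induction Ns generalizing M with
  | nil => rfl
  | cons a l ih => exact ih _

theorem red_apps_const {f : String} (Ns : List Tm) : ∀ {P}, Red (apps (.const f) Ns) P →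
    ∃ Ns', P = apps (.const f) Ns' ∧ List.Forall₂ RedStar Ns Ns' := by
  induction Ns using List.reverseRecOn with
  | nil => intro P h; cases h
  | append_singleton l a ih =>
    intro P h
    rw [apps_append] at h
    generalize hQ : apps (.const f) l = Q at h
    cases h with
    | beta =>
      exfalso
      rcases List.eq_nil_or_concat l with h | ⟨l', b, h⟩
      · subst h; cases hQ
      · rw [h, List.concat_eq_append, apps_append] at hQ; cases hQ
    | appL h =>
      subst hQ
      obtain ⟨Ns', rfl, h'⟩ := ih h
      exact ⟨Ns' ++ [a], (apps_append _ _ _).symm, List.rel_append h' (.cons .refl .nil)⟩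
    | appR h =>
      subst hQ
      exact ⟨l ++ [_], (apps_append _ _ _).symm,
        List.rel_append (List.forall₂_same.2 fun _ _ => .refl) (.cons (.single h) .nil)⟩

theorem forall₂_redStar_trans {l k : List Tm} (h1 : List.Forall₂ RedStar l k) :
    ∀ m, List.Forall₂ RedStar k m → List.Forall₂ RedStar l m := by
  induction h1 with
  | nil => intro m h; cases h; exact .nil
  | cons a _ ih =>
    intro m h
    cases h with
    | cons b h => exact .cons (a.trans b) (ih _ h)

theorem redStar_apps_const {f : String} {Ns : List Tm} {P} (h : RedStar (apps (.const f) Ns) P) :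
    ∃ Ns', P = apps (.const f) Ns' ∧ List.Forall₂ RedStar Ns Ns' := by
  induction h with
  | refl => exact ⟨Ns, rfl, List.forall₂_same.2 fun _ _ => .refl⟩
  | tail _ h ih =>
    obtain ⟨l, rfl, h1⟩ := ih
    obtain ⟨l', rfl, h2⟩ := red_apps_const l h
    refine ⟨l', rfl, ?_⟩
    exact forall₂_redStar_trans h1 _ h2

theorem redStar_var {n : ℕ} {P} (h : RedStar (.var n) P) : P = .var n := by
  induction h with
  | refl => rfl
  | tail _ h ih => subst ih; cases h

theorem apps_const_inj {f g : String} (l : List Tm) : ∀ {l' : List Tm},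
    apps (.const f) l = apps (.const g) l' → f = g ∧ l = l' := by
  induction l using List.reverseRecOn with
  | nil =>
    intro l' h
    rcases List.eq_nil_or_concat l' with h' | ⟨k, b, h'⟩
    · subst h'; cases h; simp
    · rw [h', List.concat_eq_append, apps_append] at h; cases h
  | append_singleton l a ih =>
    intro l' h
    rcases List.eq_nil_or_concat l' with h' | ⟨k, b, h'⟩
    · subst h'; rw [apps_append] at h; cases h
    · subst h'
      rw [List.concat_eq_append, apps_append, apps_append] at h
      injection h with h1 h2
      obtain ⟨h3, h4⟩ := ih h1
      simp [h2, h3, h4]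

theorem apps_const_ne_var {f : String} {n : ℕ} (l : List Tm) : apps (.const f) l ≠ .var n := by
  intro h
  rcases List.eq_nil_or_concat l with h' | ⟨k, b, h'⟩
  · subst h'; cases h
  · rw [h', List.concat_eq_append, apps_append] at h; cases h

theorem conv_apps_const {f g : String} {l l' : List Tm}
    (h : Conv (apps (.const f) l) (apps (.const g) l')) : f = g ∧ List.Forall₂ Conv l l' := by
  obtain ⟨Q, h1, h2⟩ := h.join
  obtain ⟨k, rfl, h3⟩ := redStar_apps_const h1
  obtain ⟨k', h5, h4⟩ := redStar_apps_const h2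
  obtain ⟨rfl, rfl⟩ := apps_const_inj _ h5
  refine ⟨rfl, ?_⟩
  clear h h1 h2 h5
  induction h3 generalizing l' with
  | nil => cases h4; exact .nil
  | cons a _ ih => cases h4 with
    | cons b h => exact .cons (a.conv.trans' b.conv.symm') (ih h)

theorem not_conv_const_var {f : String} {l : List Tm} {n : ℕ} :
    ¬ Conv (apps (.const f) l) (.var n) := by
  intro h
  obtain ⟨Q, h1, h2⟩ := h.join
  obtain ⟨k, rfl, h3⟩ := redStar_apps_const h1
  exact apps_const_ne_var _ (redStar_var h2)

theorem conv_var {n m : ℕ} (h : Conv (.var n) (.var m)) : n = m := by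
  obtain ⟨Q, h1, h2⟩ := h.join
  have := (redStar_var h1).symm.trans (redStar_var h2)
  injection this

/-! ## Types and typing -/

theorem Ty.order_arrow {σ τ : Ty} (h : (Ty.arrow σ τ).order ≤ 1) : σ = .base ∧ τ.order ≤ 1 := by
  simp only [Ty.order] at h
  refine ⟨?_, by omega⟩
  cases σ with
  | base => rfl
  | arrow a b => simp only [Ty.order] at h; omega

def arr : ℕ → Ty → Ty
  | 0, τ => τ
  | n + 1, τ => .arrow .base (arr n τ)

theorem eq_arr : ∀ {τ : Ty}, τ.order ≤ 1 → arr τ.arity .base = τ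
  | .base, _ => rfl
  | .arrow σ τ, h => by
    obtain ⟨rfl, h'⟩ := Ty.order_arrow h
    simp only [Ty.arity, arr, eq_arr h']

theorem arr_order {τ : Ty} (h : τ.order ≤ 1) : ∀ n, (arr n τ).order ≤ 1
  | 0 => h
  | n + 1 => by simp [arr, Ty.order, arr_order h n]

theorem arr_arity (τ : Ty) : ∀ n, (arr n τ).arity = n + τ.arity
  | 0 => by simp [arr]
  | n + 1 => by simp only [arr, Ty.arity, arr_arity τ n]; omega

theorem HasTy.apps {Sg Γ τ} (Ns : List Tm) : ∀ {M}, HasTy Sg Γ M (arr Ns.length τ) →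
    (∀ N ∈ Ns, HasTy Sg Γ N .base) → HasTy Sg Γ (apps M Ns) τ := by
  induction Ns with
  | nil => intro M h _; exact h
  | cons a l ih =>
    intro M h h2
    exact ih (.app h (h2 a (by simp))) fun N hN => h2 N (by simp [hN])

theorem Guarded.apps {Sg} (Ns : List Tm) : ∀ {M}, Guarded Sg M →
    (∀ N ∈ Ns, Guarded Sg N) → Guarded Sg (apps M Ns) := by
  induction Ns with
  | nil => intro M h _; exact h
  | cons a l ih =>
    intro M h h2
    exact ih (.app h (h2 a (by simp))) fun N hN => h2 N (by simp [hN])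

theorem replicate_shift (k : ℕ) (Γ : Ctx) :
    List.replicate k Ty.base ++ Ty.base :: Γ = List.replicate (k + 1) Ty.base ++ Γ := by
  rw [List.replicate_succ', List.append_assoc]; rfl

theorem HasTy.lams {Sg τ M} (n : ℕ) : ∀ {Γ}, HasTy Sg (List.replicate n Ty.base ++ Γ) M τ →
    HasTy Sg Γ (lams n M) (arr n τ) := by
  induction n with
  | zero => intro Γ h; exact h
  | succ n ih =>
    intro Γ h
    refine .lam (ih ?_)
    rwa [replicate_shift]

theorem GBase.order {Sg} (hSg : Sg.FirstOrder) {Γ M τ} (h : GBase Sg Γ M τ) : τ.order ≤ 1 := by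
  induction h with
  | var _ h => exact h
  | const h => exact hSg _ _ h
  | app _ _ ih _ => exact (Ty.order_arrow ih).2
  | fixI _ h => exact h

theorem GBase.hasTy {Sg} (hSg : Sg.FirstOrder) {Γ M τ} (h : GBase Sg Γ M τ) : HasTy Sg Γ M τ := by
  induction h with
  | var h _ => exact .var h
  | const h => exact .const h
  | app _ _ ih1 ih2 => exact .app ih1 ih2
  | fixI hf ho hl _ ih =>
    refine .fixI ?_
    have h1 := HasTy.apps (τ := .base) _ (.const (Γ := _) (by rw [hf, hl, eq_arr (hSg _ _ hf)])) ih
    have h2 := HasTy.lams _ h1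
    rwa [eq_arr ho] at h2

theorem HasTy.uniq {Sg Γ M τ} (h : HasTy Sg Γ M τ) : ∀ {τ'}, HasTy Sg Γ M τ' → τ = τ' := by
  induction h with
  | var h => intro τ' h'; cases h' with | var h' => rw [h] at h'; injection h'
  | const h => intro τ' h'; cases h' with | const h' => rw [h] at h'; injection h'
  | app _ _ ih _ => intro τ' h'; cases h' with | app h1 h2 => have := ih h1; injection this
  | lam _ ih => intro τ' h'; cases h' with | lam h1 => rw [ih h1]
  | fixI _ ih => intro τ' h'; cases h' with | fixI h1 => rfl

def WfR (Δ Δ' : Ctx) (r : ℕ → ℕ) : Prop := ∀ i σ, Δ[i]? = some σ → Δ'[r i]? = some σ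

theorem WfR.upr {Δ Δ' r} (h : WfR Δ Δ' r) (τ : Ty) : WfR (τ :: Δ) (τ :: Δ') (upr r) := by
  intro i σ hi
  cases i with
  | zero => simpa [Tm.upr] using hi
  | succ i => simpa [Tm.upr] using h i σ (by simpa using hi)

theorem WfR.uprn {Δ Δ' r} (h : WfR Δ Δ' r) : ∀ k,
    WfR (List.replicate k Ty.base ++ Δ) (List.replicate k Ty.base ++ Δ') (Tm.upr^[k] r)
  | 0 => h
  | k + 1 => by
    rw [Function.iterate_succ_apply']
    exact (WfR.uprn h k).upr _

theorem HasTy.ren {Sg Δ M τ} (h : HasTy Sg Δ M τ) : ∀ {Δ' r}, WfR Δ Δ' r →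
    HasTy Sg Δ' (Tm.ren r M) τ := by
  induction h with
  | var h => intro Δ' r hr; exact .var (hr _ _ h)
  | const h => intro Δ' r hr; exact .const h
  | app _ _ ih1 ih2 => intro Δ' r hr; exact .app (ih1 hr) (ih2 hr)
  | lam _ ih => intro Δ' r hr; exact .lam (ih (hr.upr _))
  | fixI _ ih => intro Δ' r hr; exact .fixI (ih (hr.upr _))

theorem wfR_nil (Δ : Ctx) (r : ℕ → ℕ) : WfR [] Δ r := by
  intro i σ h; simp at h

theorem HasTy.weaken {Sg M τ} (h : HasTy Sg [] M τ) (Δ : Ctx) : HasTy Sg Δ M τ := by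
  have := h.ren (wfR_nil Δ fun n => n)
  rwa [ren_id'] at this

theorem HasTy.inst_eq {Sg Δ M τ} (h : HasTy Sg Δ M τ) : ∀ {s : ℕ → Tm},
    (∀ i < Δ.length, s i = .var i) → inst s M = M := by
  have key : ∀ {Δ : Ctx} {s : ℕ → Tm} (τ : Ty), (∀ i < Δ.length, s i = .var i) →
      ∀ i < (τ :: Δ).length, up s i = .var i := by
    intro Δ s τ h i hi
    cases i with
    | zero => rfl
    | succ i => simp only [up]; rw [h i (by simpa using hi)]; rfl
  induction h with
  | @var Γ n τ h =>
    intro s hs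
    exact hs _ (by rw [List.getElem?_eq_some_iff] at h; exact h.1)
  | const h => intro s hs; rfl
  | app _ _ ih1 ih2 => intro s hs; simp [Tm.inst, ih1 hs, ih2 hs]
  | lam _ ih => intro s hs; simp [Tm.inst, ih (key _ hs)]
  | fixI _ ih => intro s hs; simp [Tm.inst, ih (key _ hs)]

theorem HasTy.inst_closed {Sg M τ} (h : HasTy Sg [] M τ) (s : ℕ → Tm) : inst s M = M :=
  h.inst_eq (by simp)

theorem ren_apps (r : ℕ → ℕ) (Ns : List Tm) : ∀ M,
    ren r (apps M Ns) = apps (ren r M) (Ns.map (ren r)) := by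
  induction Ns with
  | nil => intro M; rfl
  | cons a l ih => intro M; exact ih _

theorem inst_apps (s : ℕ → Tm) (Ns : List Tm) : ∀ M,
    inst s (apps M Ns) = apps (inst s M) (Ns.map (inst s)) := by
  induction Ns with
  | nil => intro M; rfl
  | cons a l ih => intro M; exact ih _

theorem ren_lams (M : Tm) (k : ℕ) : ∀ r, ren r (lams k M) = lams k (ren (upr^[k] r) M) := by
  induction k with
  | zero => intro r; rfl
  | succ k ih => intro r; simp only [lams, ren, ih]; rfl

theorem inst_lams (M : Tm) (k : ℕ) : ∀ s, inst s (lams k M) = lams k (inst (up^[k] s) M) := by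
  induction k with
  | zero => intro r; rfl
  | succ k ih => intro r; simp only [lams, inst, ih]; rfl

theorem lams_add (M : Tm) (n k : ℕ) : lams (n + k) M = lams n (lams k M) := by
  induction n with
  | zero => simp [lams]
  | succ n ih => rw [Nat.succ_add]; simp only [lams, ih]

theorem GBase.ren {Sg Δ M τ} (h : GBase Sg Δ M τ) : ∀ {Δ' r}, WfR Δ Δ' r →
    GBase Sg Δ' (Tm.ren r M) τ := by
  induction h with
  | var h ho => intro Δ' r hr; exact .var (hr _ _ h) ho
  | const h => intro Δ' r hr; exact .const h
  | app _ _ ih1 ih2 => intro Δ' r hr; exact .app (ih1 hr) (ih2 hr)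
  | fixI hf ho hl _ ih =>
    intro Δ' r hr
    simp only [Tm.ren, ren_lams, ren_apps]
    refine .fixI hf ho (by simpa using hl) ?_
    intro M hM
    obtain ⟨N, hN, rfl⟩ := List.mem_map.1 hM
    exact ih N hN ((hr.upr _).uprn _)

theorem GBase.weaken {Sg M τ} (h : GBase Sg [] M τ) (Δ : Ctx) : GBase Sg Δ M τ := by
  have := h.ren (wfR_nil Δ fun n => n)
  rwa [ren_id'] at this

def WfS (Sg : Sig) (Δ Δ' : Ctx) (s : ℕ → Tm) : Prop :=
  ∀ i σ, Δ[i]? = some σ → σ.order ≤ 1 → GBase Sg Δ' (s i) σ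

theorem WfS.up {Sg Δ Δ' s} (h : WfS Sg Δ Δ' s) (τ : Ty) : WfS Sg (τ :: Δ) (τ :: Δ') (up s) := by
  intro i σ hi ho
  cases i with
  | zero => exact .var (by simpa using hi) ho
  | succ i =>
    refine (h i σ (by simpa using hi) ho).ren ?_
    intro j ρ hj
    simpa using hj

theorem WfS.upn {Sg Δ Δ' s} (h : WfS Sg Δ Δ' s) : ∀ k,
    WfS Sg (List.replicate k Ty.base ++ Δ) (List.replicate k Ty.base ++ Δ') (Tm.up^[k] s)
  | 0 => h
  | k + 1 => by
    rw [Function.iterate_succ_apply']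
    exact (WfS.upn h k).up _

theorem GBase.inst {Sg Δ M τ} (h : GBase Sg Δ M τ) : ∀ {Δ' s}, WfS Sg Δ Δ' s →
    GBase Sg Δ' (Tm.inst s M) τ := by
  induction h with
  | var h ho => intro Δ' r hr; exact hr _ _ h ho
  | const h => intro Δ' r hr; exact .const h
  | app _ _ ih1 ih2 => intro Δ' r hr; exact .app (ih1 hr) (ih2 hr)
  | fixI hf ho hl _ ih =>
    intro Δ' r hr
    simp only [Tm.inst, inst_lams, inst_apps]
    refine .fixI hf ho (by simpa using hl) ?_
    intro M hM
    obtain ⟨N, hN, rfl⟩ := List.mem_map.1 hM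
    exact ih N hN ((hr.up _).upn _)

/-! ## Iterated β-reduction -/

def ext (s : ℕ → Tm) : List Tm → ℕ → Tm
  | [] => s
  | N :: Ns => ext (scons N s) Ns

theorem ext_add (Ns : List Tm) : ∀ (s : ℕ → Tm) (j : ℕ), ext s Ns (j + Ns.length) = s j := by
  induction Ns with
  | nil => intro s j; rfl
  | cons a l ih =>
    intro s j
    have : j + (a :: l).length = (j + 1) + l.length := by simp; omega
    rw [this]; exact ih _ _

theorem ext_lt (Ns : List Tm) : ∀ (s s' : ℕ → Tm) (j : ℕ), j < Ns.length →
    ext s Ns j ∈ Ns ∧ ext s Ns j = ext s' Ns j := by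
  induction Ns with
  | nil => intro s s' j h; simp at h
  | cons a l ih =>
    intro s s' j h
    by_cases h' : j < l.length
    · have := ih (scons a s) (scons a s') j h'
      exact ⟨List.mem_cons_of_mem _ this.1, this.2⟩
    · have : j = 0 + l.length := by simp at h; omega
      subst this
      simp only [ext, ext_add, scons]
      simp

theorem conv_fix (τ : Ty) (B : Tm) : Conv (.fix τ B) (inst (scons (.fix τ B) Tm.var) B) := by
  rw [← subst_zero]; exact .rel _ _ .fixUnfold

theorem conv_beta (τ : Ty) (M N : Tm) : Conv (.app (.lam τ M) N) (inst (scons N Tm.var) M) := by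
  rw [← subst_zero]; exact .rel _ _ .beta

theorem Conv.appsL {M M' : Tm} (h : Conv M M') (Ns : List Tm) :
    Conv (_root_.apps M Ns) (_root_.apps M' Ns) :=
  Conv.apps (List.forall₂_same.2 fun _ _ => Conv.rfl' _) h

theorem conv_apps_lams (B : Tm) (Ns : List Tm) : ∀ s,
    Conv (apps (inst s (lams Ns.length B)) Ns) (inst (ext s Ns) B) := by
  induction Ns with
  | nil => intro s; exact Conv.rfl' _
  | cons a l ih =>
    intro s
    refine Conv.trans' (Conv.appsL ?_ l) (ih (scons a s))
    rw [← inst_scons_up]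
    exact conv_beta _ _ _

/-! ## Open guarded base terms become convertible to guarded terms -/

def Gd (Sg : Sig) (Γ : Ctx) (M : Tm) : Prop := Guarded Sg M ∧ HasTy Sg Γ M .base

theorem GBase.closeUp {Sg} (hSg : Sg.FirstOrder) {Γ : Ctx} {M0 : Tm} {τ0 : Ty}
    (h0 : GBase Sg [] M0 τ0) {Ns : List Tm} (hN : ∀ N ∈ Ns, Gd Sg Γ N) {Δ M τ}
    (h : GBase Sg Δ M τ) : Δ = List.replicate Ns.length Ty.base ++ [τ0] →
    ∃ M', Guarded Sg M' ∧ HasTy Sg Γ M' τ ∧ Conv (Tm.inst (ext (scons M0 Tm.var) Ns) M) M' := by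
  induction h with
  | @var Δ n τ h ho =>
    rintro rfl
    by_cases hn : n < Ns.length
    · rw [List.getElem?_append_left (by simpa using hn)] at h
      have : τ = .base := by
        rw [List.getElem?_replicate, if_pos hn] at h; injection h with h; exact h.symm
      subst this
      have h2 := hN _ (ext_lt Ns (scons M0 Tm.var) Tm.var n hn).1
      exact ⟨_, h2.1, h2.2, Conv.rfl' _⟩
    · rw [List.getElem?_append_right (by simpa using hn)] at h
      have hn' : n = 0 + Ns.length := by
        rw [List.getElem?_eq_some_iff] at h
        obtain ⟨h, -⟩ := h
        simp at h; omega
      subst hn'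
      have : τ = τ0 := by simpa using h.symm
      subst this
      refine ⟨M0, .base h0, (h0.hasTy hSg).weaken _, ?_⟩
      simp only [Tm.inst, ext_add, scons]
      exact Conv.rfl' _
  | const h => intro _; exact ⟨_, .const, .const h, Conv.rfl' _⟩
  | app _ _ ih1 ih2 =>
    intro e
    obtain ⟨A, a1, a2, a3⟩ := ih1 e
    obtain ⟨B, b1, b2, b3⟩ := ih2 e
    exact ⟨_, .app a1 b1, .app a2 b2, a3.app b3⟩
  | @fixI Δ g σg τ Ms hf ho hl hM _ =>
    intro e
    have hfix : GBase Sg Δ _ τ := .fixI hf ho hl hM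
    generalize hbody : lams τ.arity (_root_.apps (.const g) Ms) = body at hfix ⊢
    let n := Ns.length
    let r0 : ℕ → Tm := fun j => if j = n then M0 else .var j
    let τ' := arr n τ
    let Δ3 : Ctx := List.replicate n Ty.base ++ [τ']
    have hr0 : WfS Sg Δ Δ3 r0 := by
      subst e
      intro i σ hi hso
      by_cases hin : i < Ns.length
      · have : i ≠ n := by simp only [n]; omega
        simp only [r0, if_neg this]
        refine .var ?_ hso
        rw [List.getElem?_append_left (by simpa using hin)] at hi
        simp only [Δ3]
        rw [List.getElem?_append_left (by simpa using hin)]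
        exact hi
      · rw [List.getElem?_append_right (by simpa using hin)] at hi
        have hn' : i = n := by
          rw [List.getElem?_eq_some_iff] at hi
          obtain ⟨h, -⟩ := hi
          simp at h; omega
        subst hn'
        have : σ = τ0 := by simpa [n] using hi.symm
        subst this
        simp only [r0, if_true]
        exact h0.weaken _
    let q := scons (Tm.inst r0 (.fix τ body)) r0
    have hq : WfS Sg (τ :: Δ) Δ3 q := by
      intro i σ hi hso
      cases i with
      | zero =>
        have : σ = τ := by simpa using hi.symm
        subst this
        exact hfix.inst hr0
      | succ i => exact hr0 i σ (by simpa using hi) hso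
    let Ms' := Ms.map (Tm.inst (Tm.up^[τ.arity] q))
    let B := _root_.apps (.const g) Ms'
    let F := Tm.fix τ' (lams τ'.arity B)
    have hF : GBase Sg [] F τ' := by
      refine .fixI hf (arr_order ho n) (by simpa [Ms'] using hl) ?_
      intro M hM'
      obtain ⟨N, hN', rfl⟩ := List.mem_map.1 hM'
      have := (hM N hN').inst (hq.upn _)
      simp only [Δ3] at this
      rw [← List.append_assoc, List.replicate_append_replicate, Nat.add_comm, ← arr_arity] at this
      exact this
    refine ⟨_root_.apps F Ns, .apps _ (.base hF) fun N h => (hN N h).1,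
      .apps _ ((hF.hasTy hSg).weaken _) fun N h => (hN N h).2, ?_⟩
    have hB : lams τ.arity B = Tm.inst q body := by
      rw [← hbody, inst_lams, inst_apps]; rfl
    have c1 : Conv (_root_.apps F Ns) (Tm.inst (ext (scons F Tm.var) Ns) (Tm.inst q body)) := by
      refine Conv.trans' ((conv_fix _ _).appsL Ns) ?_
      have := conv_apps_lams (lams τ.arity B) Ns (scons F Tm.var)
      rw [← lams_add, ← arr_arity, hB] at this
      exact this
    have hs : (fun j => Tm.inst (ext (scons F Tm.var) Ns) (r0 j)) = ext (scons M0 Tm.var) Ns := by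
      funext j
      by_cases hj : j < Ns.length
      · have : j ≠ n := by simp only [n]; omega
        simp only [r0, if_neg this]
        exact (ext_lt Ns _ _ j hj).2
      · obtain ⟨i, rfl⟩ : ∃ i, j = i + Ns.length := ⟨j - Ns.length, by omega⟩
        rw [ext_add]
        cases i with
        | zero =>
          simp only [r0, n, Nat.zero_add, if_true]
          exact (h0.hasTy hSg).inst_closed _
        | succ i =>
          have : i + 1 + Ns.length ≠ n := by simp only [n]; omega
          simp only [r0, if_neg this, Tm.inst]
          exact ext_add _ _ _
    refine Conv.trans' ?_ c1.symm'
    rw [inst_inst_scons', inst_inst, hs, ← inst_scons_up]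
    exact conv_fix _ _

/-! ## The logical relation -/

def hdTm {Sg : Sig} {Γ : Ctx} : (coSig Sg (Fin Γ.length)) (GFOTm Sg Γ) → Tm
  | ⟨.inl f, Ns⟩ => apps (.const f) (List.ofFn fun i : Fin (Sg.ar f) => (Ns i).1)
  | ⟨.inr x, _⟩ => .var x.1

def RedP (Sg : Sig) (Γ : Ctx) : Ty → Tm → Prop
  | .base, M => ∃ h : (coSig Sg (Fin Γ.length)) (GFOTm Sg Γ), Gd Sg Γ (hdTm h) ∧ Conv M (hdTm h)
  | .arrow σ τ, M => ∀ N, RedP Sg Γ σ N → RedP Sg Γ τ (.app M N)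

theorem RedP.conv {Sg Γ} : ∀ {τ M M'}, RedP Sg Γ τ M → Conv M' M → RedP Sg Γ τ M'
  | .base, _, _, ⟨h, h1, h2⟩, hc => ⟨h, h1, hc.trans' h2⟩
  | .arrow _ _, _, _, h, hc => fun N hN => (h N hN).conv (hc.app (Conv.rfl' _))

theorem RedP.of_apps {Sg Γ} : ∀ {τ : Ty}, τ.order ≤ 1 → ∀ {M},
    (∀ Ns : List Tm, Ns.length = τ.arity → (∀ N ∈ Ns, RedP Sg Γ .base N) →
      RedP Sg Γ .base (apps M Ns)) → RedP Sg Γ τ M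
  | .base, _, _, h => h [] rfl (by simp)
  | .arrow σ τ, ho, M, h => by
    obtain ⟨rfl, h'⟩ := Ty.order_arrow ho
    intro N hN
    refine RedP.of_apps h' ?_
    intro Ns hl hNs
    refine h (N :: Ns) (by simp [Ty.arity, hl]) ?_
    intro P hP
    rcases List.mem_cons.1 hP with rfl | hP
    · exact hN
    · exact hNs P hP

theorem collect {Sg Γ} (P : Tm → Prop) (Ns : List Tm) (hP : ∀ N, P N → ∃ N', Gd Sg Γ N' ∧ Conv N N')
    (h : ∀ N ∈ Ns, P N) :
    ∃ Ns', List.Forall₂ Conv Ns Ns' ∧ ∀ N ∈ Ns', Gd Sg Γ N := by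
  induction Ns with
  | nil => exact ⟨[], .nil, by simp⟩
  | cons a l ih =>
    obtain ⟨l', h1, h2⟩ := ih fun N hN => h N (by simp [hN])
    obtain ⟨a', h3, h4⟩ := hP a (h a (by simp))
    refine ⟨a' :: l', .cons h4 h1, ?_⟩
    intro N hN
    rcases List.mem_cons.1 hN with rfl | hN
    · exact h3
    · exact h2 N hN

theorem RedP.mk {Sg} (hSg : Sg.FirstOrder) {Γ f σ M} {Ls : List Tm} (hf : Sg f = some σ)
    (hl : Ls.length = σ.arity) (hL : ∀ N ∈ Ls, Gd Sg Γ N) (hc : Conv M (apps (.const f) Ls)) :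
    RedP Sg Γ .base M := by
  have har : Sg.ar f = Ls.length := by simp [Sig.ar, hf, hl]
  let h : (coSig Sg (Fin Γ.length)) (GFOTm Sg Γ) :=
    ⟨.inl f, fun i : Fin (Sg.ar f) => ⟨Ls[i.1]'(by have := i.2; omega), hL _ (by simp)⟩⟩
  have hh : hdTm h = apps (.const f) Ls := by
    simp only [hdTm, h]
    congr 1
    apply List.ext_getElem
    · simp [har]
    · intro i h1 h2
      simp
  refine ⟨h, ?_, ?_⟩
  · rw [hh]
    refine ⟨.apps _ .const fun N h => (hL N h).1, .apps _ (.const ?_) fun N h => (hL N h).2⟩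
    rw [hf, hl, eq_arr (hSg _ _ hf)]
  · rw [hh]; exact hc

theorem RedP.const {Sg} (hSg : Sg.FirstOrder) {Γ f σ} (hf : Sg f = some σ) :
    RedP Sg Γ σ (.const f) := by
  refine RedP.of_apps (hSg _ _ hf) ?_
  intro Ns hl hNs
  obtain ⟨Ls, h1, h2⟩ := collect _ Ns (fun N hN => by
    obtain ⟨h, h1, h2⟩ := hN; exact ⟨_, h1, h2⟩) hNs
  exact RedP.mk hSg hf (h1.length_eq.symm.trans hl) h2 (Conv.apps h1 (Conv.rfl' _))

theorem RedP.gbase {Sg} (hSg : Sg.FirstOrder) {Γ Δ M τ} (h : GBase Sg Δ M τ) :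
    Δ = [] → RedP Sg Γ τ M := by
  induction h with
  | var h _ => rintro rfl; simp at h
  | const h => intro _; exact RedP.const hSg h
  | app _ _ ih1 ih2 => intro e; exact ih1 e _ (ih2 e)
  | @fixI Δ f σf τ Ms hf ho hl hM _ =>
    rintro rfl
    have hfix : GBase Sg [] _ τ := .fixI hf ho hl hM
    refine RedP.of_apps ho ?_
    intro Ns hNl hNs
    obtain ⟨Ls, h1, h2⟩ := collect _ Ns (fun N hN => by
      obtain ⟨h, h1, h2⟩ := hN; exact ⟨_, h1, h2⟩) hNs
    have hLl : Ls.length = τ.arity := h1.length_eq.symm.trans hNl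
    rw [← hLl] at hfix hM ⊢
    generalize hM0 : Tm.fix τ (lams Ls.length (_root_.apps (.const f) Ms)) = M0 at hfix ⊢
    obtain ⟨Ks, h3, h4⟩ := collect (Sg := Sg) (Γ := Γ)
      (fun N => ∃ M ∈ Ms, N = inst (ext (scons M0 Tm.var) Ls) M)
      (Ms.map (inst (ext (scons M0 Tm.var) Ls))) (by
        rintro N ⟨M, hMm, rfl⟩
        obtain ⟨M', a, b, c⟩ := GBase.closeUp hSg hfix h2 (hM M hMm) rfl
        exact ⟨M', ⟨a, b⟩, c⟩) (by
        intro N hN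
        obtain ⟨M, hM, rfl⟩ := List.mem_map.1 hN
        exact ⟨M, hM, rfl⟩)
    refine RedP.mk hSg hf (Ls := Ks) (by rw [← h3.length_eq]; simpa using hl) h4 ?_
    refine Conv.trans' (Conv.apps h1 (Conv.rfl' _)) ?_
    have c1 : Conv M0 (inst (scons M0 Tm.var) (lams Ls.length (_root_.apps (.const f) Ms))) := by
      have := conv_fix τ (lams Ls.length (_root_.apps (.const f) Ms))
      rwa [hM0] at this
    refine Conv.trans' (c1.appsL Ls) ?_
    refine Conv.trans' (conv_apps_lams _ _ _) ?_
    rw [inst_apps]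
    exact Conv.apps h3 (Conv.rfl' _)

theorem RedP.fundamental {Sg} (hSg : Sg.FirstOrder) {Γ M} (h : Guarded Sg M) :
    ∀ {Δ τ}, HasTy Sg Δ M τ → ∀ s : ℕ → Tm, (∀ i σ, Δ[i]? = some σ → RedP Sg Γ σ (s i)) →
      RedP Sg Γ τ (inst s M) := by
  induction h with
  | base h =>
    intro Δ τ ht s hs
    have := ((h.hasTy hSg).weaken Δ).uniq ht
    subst this
    rw [(h.hasTy hSg).inst_closed]
    exact RedP.gbase hSg h rfl
  | const => intro Δ τ ht s hs; cases ht with | const h => exact RedP.const hSg h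
  | var => intro Δ τ ht s hs; cases ht with | var h => exact hs _ _ h
  | app _ _ ih1 ih2 =>
    intro Δ τ ht s hs
    cases ht with | app h1 h2 => exact ih1 h1 s hs _ (ih2 h2 s hs)
  | lam _ ih =>
    intro Δ τ ht s hs
    cases ht with
    | lam h1 =>
      intro N hN
      refine RedP.conv (ih h1 (scons N s) ?_) ?_
      · intro i σ hi
        cases i with
        | zero =>
          have := Option.some.inj (show some _ = some σ from hi)
          subst this
          exact hN
        | succ i => exact hs i σ (by simpa using hi)
      · rw [← inst_scons_up]; exact conv_beta _ _ _

theorem exists_head {Sg} (hSg : Sg.FirstOrder) {Γ : Ctx} (hΓ : ∀ τ ∈ Γ, τ = Ty.base)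
    (M : GFOTm Sg Γ) : ∃ h : (coSig Sg (Fin Γ.length)) (GFOTm Sg Γ),
      Gd Sg Γ (hdTm h) ∧ Conv M.1 (hdTm h) := by
  have := RedP.fundamental (Γ := Γ) hSg M.2.1 M.2.2 Tm.var (by
    intro i σ hi
    have hi' := hi
    rw [List.getElem?_eq_some_iff] at hi'
    obtain ⟨hlt, he⟩ := hi'
    have : σ = .base := hΓ σ (by rw [← he]; exact List.getElem_mem _)
    subst this
    exact ⟨⟨.inr ⟨i, hlt⟩, fun e => e.elim⟩, ⟨.var, .var hi⟩, Conv.rfl' _⟩)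
  rw [inst_var] at this
  exact this

theorem conv_hdTm {Sg : Sig} {Γ : Ctx} {h h' : (coSig Sg (Fin Γ.length)) (GFOTm Sg Γ)}
    (hc : Conv (hdTm h) (hdTm h')) :
    ∃ a k k', h = ⟨a, k⟩ ∧ h' = ⟨a, k'⟩ ∧ ∀ i, Conv (k i).1 (k' i).1 := by
  obtain ⟨a | x, k⟩ := h <;> obtain ⟨b | y, k'⟩ := h' <;> simp only [hdTm] at hc
  · obtain ⟨rfl, h2⟩ := conv_apps_const hc
    refine ⟨_, _, _, rfl, rfl, ?_⟩
    intro i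
    rw [List.forall₂_iff_get] at h2
    have hi : i.1 < Sg.ar a := i.2
    have := h2.2 i.1 (by simpa using hi) (by simpa using hi)
    simp only [List.get_ofFn] at this
    exact this
  · exact (not_conv_const_var hc).elim
  · exact (not_conv_const_var hc.symm').elim
  · have := Fin.ext (conv_var hc)
    subst this
    exact ⟨_, _, _, rfl, rfl, fun e => e.elim⟩

/-- **Semantics of first-order guarded terms in coterms**: there is a unique map
`⟦-⟧` from first-order guarded terms of base type over `Γ` (all of whose
variables have base type) to coterms over `Γ` such that
(1) `⟦-⟧` identifies convertible terms, and
(2) if `M ↠ f N₁ … N_{ar f}` then `root ⟦M⟧ = f(⟦N₁⟧, …, ⟦N_{ar f}⟧)`, and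
if `M ↠ x` then `root ⟦M⟧ = x`. -/
theorem coterm_semantics_exists_unique (Sg : Sig) (hSg : Sg.FirstOrder)
    (Γ : Ctx) (hΓ : ∀ τ ∈ Γ, τ = Ty.base) :
    ∃! sem : GFOTm Sg Γ → CoTerm Sg (Fin Γ.length),
      (∀ M N : GFOTm Sg Γ, Conv M.1 N.1 → sem M = sem N) ∧
      (∀ (M : GFOTm Sg Γ) (f : String) (Ns : Fin (Sg.ar f) → GFOTm Sg Γ),
        RedStar M.1 (apps (.const f) (List.ofFn fun i => (Ns i).1)) →
        PFunctor.M.dest (sem M) = ⟨Sum.inl f, fun i => sem (Ns i)⟩) ∧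
      (∀ (M : GFOTm Sg Γ) (x : Fin Γ.length), RedStar M.1 (.var x.1) →
        PFunctor.M.dest (sem M) = ⟨Sum.inr x, fun e => e.elim⟩) := by
  classical
  choose c hc1 hc2 using exists_head hSg hΓ
  let sem : GFOTm Sg Γ → (coSig Sg (Fin Γ.length)).M := PFunctor.M.corec c
  have hdest : ∀ M, PFunctor.M.dest (sem M) = (coSig Sg (Fin Γ.length)).map sem (c M) :=
    fun M => PFunctor.M.dest_corec c M
  have hconv : ∀ M N : GFOTm Sg Γ, Conv M.1 N.1 → sem M = sem N := by
    intro M N h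
    refine PFunctor.M.bisim (fun x y => ∃ M N : GFOTm Sg Γ, Conv M.1 N.1 ∧ x = sem M ∧ y = sem N)
      ?_ _ _ ⟨M, N, h, rfl, rfl⟩
    rintro _ _ ⟨M, N, h, rfl, rfl⟩
    obtain ⟨a, k, k', e1, e2, h3⟩ := conv_hdTm (((hc2 M).symm'.trans' h).trans' (hc2 N))
    refine ⟨a, sem ∘ k, sem ∘ k', ?_, ?_, fun i => ⟨k i, k' i, h3 i, rfl, rfl⟩⟩
    · rw [hdest, e1]; rfl
    · rw [hdest, e2]; rfl
  have hroot : ∀ (M : GFOTm Sg Γ) (h : (coSig Sg (Fin Γ.length)) (GFOTm Sg Γ)),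
      Conv M.1 (hdTm h) → PFunctor.M.dest (sem M) = (coSig Sg (Fin Γ.length)).map sem h := by
    intro M h hM
    obtain ⟨a, k, k', e1, e2, h3⟩ := conv_hdTm ((hc2 M).symm'.trans' hM)
    rw [hdest, e1, e2]
    have : sem ∘ k = sem ∘ k' := funext fun i => hconv _ _ (h3 i)
    rw [PFunctor.map_eq, PFunctor.map_eq, this]
  refine ⟨sem, ⟨hconv, ?_, ?_⟩, ?_⟩
  · intro M f Ns h
    exact hroot M ⟨Sum.inl f, Ns⟩ h.conv
  · intro M x h
    have := hroot M ⟨Sum.inr x, fun e => e.elim⟩ h.conv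
    refine Eq.trans this ?_
    exact congrArg (Sigma.mk (β := fun a => (coSig Sg (Fin Γ.length)).B a →
      (coSig Sg (Fin Γ.length)).M) (Sum.inr x)) (funext fun e => Empty.elim e)
  · rintro sem' ⟨h1, h2, h3⟩
    refine PFunctor.M.corec_unique c sem' ?_
    intro M
    have e := h1 M ⟨hdTm (c M), hc1 M⟩ (hc2 M)
    have key : ∀ (h : (coSig Sg (Fin Γ.length)) (GFOTm Sg Γ)) (hg : Gd Sg Γ (hdTm h)),
        PFunctor.M.dest (sem' ⟨hdTm h, hg⟩) = (coSig Sg (Fin Γ.length)).map sem' h := by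
      rintro ⟨f | x, k⟩ hg
      · exact h2 _ f k .refl
      · refine Eq.trans (h3 _ x .refl) ?_
        exact congrArg (Sigma.mk (β := fun a => (coSig Sg (Fin Γ.length)).B a →
          (coSig Sg (Fin Γ.length)).M) (Sum.inr x)) (funext fun e => Empty.elim e)
    rw [e]
    exact key _ _
end

section
/- Löb rule on descending chains: for every set X and every descending chain u over X, the chain exponent (▷u ⇒̇ u) is below u; that is, for every ordinal α, ⋂_{β≤α} { x : x ∈ (⋂_{γ<β} u γ) → x ∈ u β } ⊆ u α. -/
/-- The later modality on descending chains: `(▷u) α = ⋂_{β<α} u β`. -/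
def laterC {X : Type*} (u : Ordinal → Set X) : Ordinal → Set X :=
  fun α => ⋂ β < α, u β

/-- The chain exponent: `(v ⇒̇ u) α = ⋂_{β≤α} { x | x ∈ v β → x ∈ u β }`. -/
def expC {X : Type*} (v u : Ordinal → Set X) : Ordinal → Set X :=
  fun α => ⋂ β ≤ α, {x | x ∈ v β → x ∈ u β}

/-- **Löb rule on descending chains**: for every descending chain `u` over `X`,
the chain exponent `▷u ⇒̇ u` is pointwise below `u`. -/
theorem lob_chain {X : Type*} (u : Ordinal → Set X) (hu : Antitone u) (α : Ordinal) :
    expC (laterC u) u α ⊆ u α := by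
  intro x hx
  simp only [expC, laterC, Set.mem_iInter, Set.mem_setOf_eq] at hx
  have key : ∀ β, β ≤ α → x ∈ u β := by
    intro β
    induction β using WellFoundedLT.induction with
    | ind β ih =>
      intro hβ
      exact hx β hβ (fun γ hγ => ih γ hγ (hγ.le.trans hβ))
  exact key α le_rfl
end

section
/- The chain exponent gives fibred exponents on descending chains: for descending chains u, v over a set X, the chain (v ⇒̇ u) is again a descending chain, and for every descending chain w over X: w ≤ (v ⇒̇ u) pointwise if and only if w ⊓ v ≤ u pointwise. -/
/-- **Fibred exponents on descending chains**: for descending chains `u`, `v` over `X`,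
the chain exponent `v ⇒̇ u` is again a descending chain, and for every descending
chain `w`, `w ≤ (v ⇒̇ u)` pointwise iff `w ⊓ v ≤ u` pointwise. -/
theorem expC_fibred_exponent {X : Type*}
    (u v : Ordinal → Set X) (hu : Antitone u) (hv : Antitone v) :
    Antitone (expC v u) ∧
    (∀ w : Ordinal → Set X, Antitone w →
      ((∀ α, w α ⊆ expC v u α) ↔ (∀ α, w α ∩ v α ⊆ u α))) := by
  have key : ∀ α x, x ∈ expC v u α ↔ ∀ β ≤ α, x ∈ v β → x ∈ u β := by
    intro α x
    simp only [expC, Set.mem_iInter, Set.mem_setOf_eq]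
  refine ⟨?_, ?_⟩
  · intro a b hab x hx
    exact (key a x).2 fun β hβ => (key b x).1 hx β (hβ.trans hab)
  · intro w hw
    constructor
    · rintro h α x ⟨hxw, hxv⟩
      exact (key α x).1 (h α hxw) α le_rfl hxv
    · intro h α x hx
      exact (key α x).2 fun β hβ hxv => h β ⟨hw hβ hx, hxv⟩
end
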